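/- For s≥0 let H^s(ℝⁿ) = {u∈L²(ℝⁿ,ℂ): ∫_{ℝⁿ}(1+|ξ|²)^s |û(ξ)|² dξ < ∞}, where û denotes the Fourier–Plancherel transform of u, with norm ‖u‖_{H^s(ℝⁿ)} = (∫_{ℝⁿ}(1+|ξ|²)^s|û(ξ)|² dξ)^{1/2}. Then for all 0≤s0≤s1, 0<θ<1 and s=(1−θ)s0+θs1, with normalisation N_{θ,2}=((2/π)sin(πθ))^{1/2}, the K-interpolation space of the pair (H^{s0}(ℝⁿ),H^{s1}(ℝⁿ)) equals H^s(ℝⁿ) as a set, and ‖u‖_{K_{θ,2}((H^{s0}(ℝⁿ),H^{s1}(ℝⁿ)))} = ‖u‖_{H^s(ℝⁿ)} for every u∈H^s(ℝⁿ); that is, these Sobolev spaces form an exact interpolation scale. -/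

import Mathlib

open MeasureTheory Set Filter Topology
open scoped ENNReal NNReal RealInnerProductSpace

noncomputable section

/-- The measure `dt/t` on `(0,∞)`. -/
def logMeasure : Measure ℝ :=
  (volume.restrict (Set.Ioi (0:ℝ))).withDensity (fun t => ENNReal.ofReal t⁻¹)

/-- The weighted norm `‖F‖_{θ,2} = (∫₀^∞ (t^{-θ} F(t))² dt/t)^{1/2}`. -/
def thetaNorm2E (θ : ℝ) (F : ℝ → ℝ≥0∞) : ℝ≥0∞ :=
  (∫⁻ t, (ENNReal.ofReal (t ^ (-θ)) * F t) ^ (2:ℝ) ∂logMeasure) ^ (1/2 : ℝ)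

/-- `N_{θ,2} = ((2/π) sin (π θ))^{1/2}`. -/
def N2 (θ : ℝ) : ℝ := Real.sqrt (2 / Real.pi * Real.sin (Real.pi * θ))

variable (n : ℕ)
  (F : Lp ℂ 2 (volume : Measure (EuclideanSpace ℝ (Fin n))) ≃ₗᵢ[ℂ]
       Lp ℂ 2 (volume : Measure (EuclideanSpace ℝ (Fin n))))

/-- The Sobolev norm `‖u‖_{H^s(ℝⁿ)} = (∫ (1+|ξ|²)^s |û(ξ)|² dξ)^{1/2}`, where `û = F u`
is the Fourier–Plancherel transform of `u`. -/
def sobNorm (s : ℝ) (u : Lp ℂ 2 (volume : Measure (EuclideanSpace ℝ (Fin n)))) : ℝ≥0∞ :=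
  (∫⁻ ξ, ENNReal.ofReal ((1 + ‖ξ‖ ^ 2) ^ s) * ((‖(F u) ξ‖₊ : ℝ≥0∞)) ^ (2:ℕ)) ^ (1/2 : ℝ)

/-- The Sobolev space `H^s(ℝⁿ) = {u ∈ L²(ℝⁿ) : ‖u‖_{H^s(ℝⁿ)} < ∞}` (for `s ≥ 0`). -/
def sobSet (s : ℝ) : Set (Lp ℂ 2 (volume : Measure (EuclideanSpace ℝ (Fin n)))) :=
  {u | sobNorm n F s u < ⊤}

/-- The K-functional for the pair `(H^{s0}(ℝⁿ), H^{s1}(ℝⁿ))`. -/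
def sobKfun (s0 s1 t : ℝ) (u : Lp ℂ 2 (volume : Measure (EuclideanSpace ℝ (Fin n)))) : ℝ≥0∞ :=
  sInf {r | ∃ u0 ∈ sobSet n F s0, ∃ u1 ∈ sobSet n F s1, u0 + u1 = u ∧
    r = ((sobNorm n F s0 u0) ^ (2:ℕ) +
          ENNReal.ofReal (t ^ 2) * (sobNorm n F s1 u1) ^ (2:ℕ)) ^ (1/2 : ℝ)}

/-- The `K_{θ,2}` norm for the pair `(H^{s0}(ℝⁿ), H^{s1}(ℝⁿ))`, with normalisation
`N_{θ,2} = ((2/π) sin (πθ))^{1/2}`. -/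
def sobKnorm (s0 s1 θ : ℝ) (u : Lp ℂ 2 (volume : Measure (EuclideanSpace ℝ (Fin n)))) :
    ℝ≥0∞ :=
  ENNReal.ofReal (N2 θ) * thetaNorm2E θ (fun t => sobKfun n F s0 s1 t u)

theorem lintegral_exp_neg_mul_Ioi {c : ℝ} (hc : 0 < c) :
    ∫⁻ y in Ioi (0:ℝ), ENNReal.ofReal (Real.exp (-(c * y))) = ENNReal.ofReal c⁻¹ := by
  rw [← ofReal_integral_eq_lintegral_ofReal]
  · congr 1
    have h := integral_exp_neg_mul_rpow (p := 1) (b := c) one_pos hc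
    simpa [Real.rpow_neg_one, one_add_one_eq_two, Real.Gamma_two] using h
  · simpa [IntegrableOn] using exp_neg_integrableOn_Ioi 0 hc
  · exact ae_of_all _ fun _ => (Real.exp_pos _).le

theorem lintegral_rpow_mul_exp_neg_mul_rpow {p q b : ℝ} (hp : 0 < p) (hq : -1 < q)
    (hb : 0 < b) :
    ∫⁻ x in Ioi (0:ℝ), ENNReal.ofReal (x ^ q * Real.exp (-b * x ^ p)) =
      ENNReal.ofReal (b ^ (-(q + 1) / p) * (1 / p) * Real.Gamma ((q + 1) / p)) := by
  rw [← integral_rpow_mul_exp_neg_mul_rpow hp hq hb, ← ofReal_integral_eq_lintegral_ofReal]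
  · by_contra h
    have h0 := integral_undef h
    rw [integral_rpow_mul_exp_neg_mul_rpow hp hq hb] at h0
    have h1 : 0 < Real.Gamma ((q + 1) / p) := Real.Gamma_pos_of_pos (div_pos (by linarith) hp)
    have : 0 < b ^ (-(q + 1) / p) * (1 / p) * Real.Gamma ((q + 1) / p) := by positivity
    linarith
  · filter_upwards [ae_restrict_mem measurableSet_Ioi] with x hx
    have hx : 0 < x := hx
    positivity

/-- The Mellin-type integral behind the normalisation `N_{θ,2}`. -/
theorem lintegral_rpow_div_add_sq_mul {A B θ : ℝ} (hA : 0 < A) (hB : 0 < B) (hθ0 : 0 < θ)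
    (hθ1 : θ < 1) :
    ∫⁻ t in Ioi (0:ℝ), ENNReal.ofReal (t ^ (1 - 2 * θ) * (A * B / (A + t ^ 2 * B))) =
      ENNReal.ofReal (A ^ (1 - θ) * B ^ θ * (Real.pi / (2 * Real.sin (Real.pi * θ)))) := by
  have hexp (t : ℝ) (ht : t ∈ Ioi (0:ℝ)) :
      ENNReal.ofReal (t ^ (1 - 2 * θ) * (A * B / (A + t ^ 2 * B))) =
        ∫⁻ y in Ioi (0:ℝ), ENNReal.ofReal (t ^ (1 - 2 * θ) * (A * B)) *
          ENNReal.ofReal (Real.exp (-((A + t ^ 2 * B) * y))) := by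
    have ht : 0 < t := ht
    rw [lintegral_const_mul _ (by fun_prop), lintegral_exp_neg_mul_Ioi (by positivity),
      ← ENNReal.ofReal_mul (by positivity)]
    congr 1
    ring
  have hinner (y : ℝ) (hy : y ∈ Ioi (0:ℝ)) :
      ∫⁻ t in Ioi (0:ℝ), ENNReal.ofReal (t ^ (1 - 2 * θ) * (A * B)) *
          ENNReal.ofReal (Real.exp (-((A + t ^ 2 * B) * y))) =
        ENNReal.ofReal (A * B ^ θ * (1 / 2) * Real.Gamma (1 - θ)) *
          ENNReal.ofReal (y ^ (θ - 1) * Real.exp (-A * y ^ (1:ℝ))) := by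
    have hy : 0 < y := hy
    have hG : 0 < Real.Gamma (1 - θ) := Real.Gamma_pos_of_pos (by linarith)
    have h (t : ℝ) (ht : t ∈ Ioi (0:ℝ)) :
        ENNReal.ofReal (t ^ (1 - 2 * θ) * (A * B)) *
          ENNReal.ofReal (Real.exp (-((A + t ^ 2 * B) * y))) =
        ENNReal.ofReal (A * B * Real.exp (-A * y)) *
          ENNReal.ofReal (t ^ (1 - 2 * θ) * Real.exp (-(B * y) * t ^ (2:ℝ))) := by
      have ht : 0 < t := ht
      rw [← ENNReal.ofReal_mul (by positivity), ← ENNReal.ofReal_mul (by positivity)]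
      have : Real.exp (-((A + t ^ 2 * B) * y)) =
          Real.exp (-A * y) * Real.exp (-(B * y) * t ^ 2) := by
        rw [← Real.exp_add]; ring_nf
      rw [this, Real.rpow_two]
      ring_nf
    rw [setLIntegral_congr_fun measurableSet_Ioi h,
      lintegral_const_mul _ (by fun_prop),
      lintegral_rpow_mul_exp_neg_mul_rpow two_pos (by linarith) (by positivity),
      ← ENNReal.ofReal_mul (by positivity), ← ENNReal.ofReal_mul (by positivity)]
    have e1 : -(1 - 2 * θ + 1) / 2 = θ - 1 := by ring
    have e2 : (1 - 2 * θ + 1) / 2 = 1 - θ := by ring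
    rw [e1, e2, Real.mul_rpow hB.le hy.le, Real.rpow_one, Real.rpow_sub_one hB.ne']
    congr 1
    field_simp
  rw [setLIntegral_congr_fun measurableSet_Ioi hexp,
    lintegral_lintegral_swap (by fun_prop),
    setLIntegral_congr_fun measurableSet_Ioi hinner,
    lintegral_const_mul _ (by fun_prop),
    lintegral_rpow_mul_exp_neg_mul_rpow one_pos (by linarith) hA]
  have hG : 0 < Real.Gamma (1 - θ) := Real.Gamma_pos_of_pos (by linarith)
  rw [← ENNReal.ofReal_mul (by positivity)]
  congr 1
  have hr : Real.pi / (2 * Real.sin (Real.pi * θ)) =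
      1 / 2 * (Real.Gamma θ * Real.Gamma (1 - θ)) := by
    rw [Real.Gamma_mul_Gamma_one_sub]; ring
  have e1 : -(θ - 1 + 1) / 1 = -θ := by ring
  have e2 : (θ - 1 + 1) / 1 = θ := by ring
  rw [hr, e1, e2, Real.rpow_sub hA, Real.rpow_one, Real.rpow_neg hA.le]
  ring

theorem ENNReal.rpow_half_sq (x : ℝ≥0∞) : (x ^ (1 / 2 : ℝ)) ^ (2:ℕ) = x := by
  rw [← ENNReal.rpow_natCast, ← ENNReal.rpow_mul]
  norm_num

theorem coe_nnnorm_sq_eq_ofReal (z : ℂ) :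
    ((‖z‖₊ : ℝ≥0∞)) ^ (2:ℕ) = ENNReal.ofReal (‖z‖ ^ 2) := by
  rw [ENNReal.ofReal_pow (norm_nonneg _), ofReal_norm, enorm_eq_nnnorm]

/-- Pointwise lower bound for the K-functional of a weighted couple. -/
theorem ofReal_mul_nnnorm_add_sq_le {A B : ℝ} (hA : 0 < A) (hB : 0 < B) (t : ℝ) (x y : ℂ) :
    ENNReal.ofReal (t ^ 2 * (A * B / (A + t ^ 2 * B))) * (‖x + y‖₊ : ℝ≥0∞) ^ (2:ℕ) ≤
      ENNReal.ofReal A * (‖x‖₊ : ℝ≥0∞) ^ (2:ℕ) +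
        ENNReal.ofReal (t ^ 2) * (ENNReal.ofReal B * (‖y‖₊ : ℝ≥0∞) ^ (2:ℕ)) := by
  simp only [coe_nnnorm_sq_eq_ofReal]
  rw [← ENNReal.ofReal_mul (by positivity), ← ENNReal.ofReal_mul hA.le,
    ← ENNReal.ofReal_mul hB.le, ← ENNReal.ofReal_mul (by positivity),
    ← ENNReal.ofReal_add (by positivity) (by positivity)]
  apply ENNReal.ofReal_le_ofReal
  have hsq : ‖x + y‖ ^ 2 ≤ (‖x‖ + ‖y‖) ^ 2 := by gcongr; exact norm_add_le x y
  have hD : 0 < A + t ^ 2 * B := by positivity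
  calc t ^ 2 * (A * B / (A + t ^ 2 * B)) * ‖x + y‖ ^ 2
      ≤ t ^ 2 * (A * B / (A + t ^ 2 * B)) * (‖x‖ + ‖y‖) ^ 2 := by gcongr
    _ = t ^ 2 * A * B * (‖x‖ + ‖y‖) ^ 2 / (A + t ^ 2 * B) := by ring
    _ ≤ _ := by
      rw [div_le_iff₀ hD]
      nlinarith [sq_nonneg (A * ‖x‖ - t ^ 2 * B * ‖y‖)]

/-- The pointwise minimiser attains the lower bound of `ofReal_mul_nnnorm_add_sq_le`. -/
theorem ofReal_mul_nnnorm_sq_minimizer {A B : ℝ} (hA : 0 < A) (hB : 0 < B) (t : ℝ) (z : ℂ) :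
    ENNReal.ofReal A * (‖((t ^ 2 * B / (A + t ^ 2 * B) : ℝ) : ℂ) * z‖₊ : ℝ≥0∞) ^ (2:ℕ) +
        ENNReal.ofReal (t ^ 2) *
          (ENNReal.ofReal B * (‖z - ((t ^ 2 * B / (A + t ^ 2 * B) : ℝ) : ℂ) * z‖₊ : ℝ≥0∞) ^ (2:ℕ)) =
      ENNReal.ofReal (t ^ 2 * (A * B / (A + t ^ 2 * B))) * (‖z‖₊ : ℝ≥0∞) ^ (2:ℕ) := by
  have hD : 0 < A + t ^ 2 * B := by positivity
  have h1 : z - ((t ^ 2 * B / (A + t ^ 2 * B) : ℝ) : ℂ) * z =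
      ((A / (A + t ^ 2 * B) : ℝ) : ℂ) * z := by
    have : A / (A + t ^ 2 * B) = 1 - t ^ 2 * B / (A + t ^ 2 * B) := by field_simp; ring
    rw [this]; push_cast; ring
  simp only [h1, coe_nnnorm_sq_eq_ofReal, norm_mul, Complex.norm_real, mul_pow, Real.norm_eq_abs,
    sq_abs]
  rw [← ENNReal.ofReal_mul hA.le, ← ENNReal.ofReal_mul hB.le, ← ENNReal.ofReal_mul (sq_nonneg t),
    ← ENNReal.ofReal_mul (by positivity), ← ENNReal.ofReal_add (by positivity) (by positivity)]
  congr 1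
  field_simp
  ring

/-- The Bessel-type weight `(1+|ξ|²)^s`. -/
def besselWeight (s : ℝ) (ξ : EuclideanSpace ℝ (Fin n)) : ℝ := (1 + ‖ξ‖ ^ 2) ^ s

theorem besselWeight_pos (s : ℝ) (ξ : EuclideanSpace ℝ (Fin n)) : 0 < besselWeight n s ξ := by
  unfold besselWeight; positivity

@[fun_prop]
theorem measurable_besselWeight (s : ℝ) : Measurable (besselWeight n s) := by
  unfold besselWeight; fun_prop

theorem sobNorm_sq (s : ℝ) (u : Lp ℂ 2 (volume : Measure (EuclideanSpace ℝ (Fin n)))) :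
    sobNorm n F s u ^ (2:ℕ) =
      ∫⁻ ξ, ENNReal.ofReal (besselWeight n s ξ) * (‖(F u) ξ‖₊ : ℝ≥0∞) ^ (2:ℕ) :=
  ENNReal.rpow_half_sq _

theorem measurable_nnnorm_Lp (v : Lp ℂ 2 (volume : Measure (EuclideanSpace ℝ (Fin n)))) :
    Measurable fun ξ => (‖v ξ‖₊ : ℝ≥0∞) :=
  (Lp.stronglyMeasurable v).measurable.nnnorm.coe_nnreal_ennreal

/-- Closed form of the K-functional on the Fourier side. -/
theorem sobKfun_eq (s0 s1 t : ℝ) (ht : 0 < t)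
    (u : Lp ℂ 2 (volume : Measure (EuclideanSpace ℝ (Fin n)))) :
    sobKfun n F s0 s1 t u =
      (∫⁻ ξ, ENNReal.ofReal (t ^ 2 * (besselWeight n s0 ξ * besselWeight n s1 ξ /
          (besselWeight n s0 ξ + t ^ 2 * besselWeight n s1 ξ))) *
        (‖(F u) ξ‖₊ : ℝ≥0∞) ^ (2:ℕ)) ^ (1/2 : ℝ) := by
  have hsum (v0 v1 : Lp ℂ 2 (volume : Measure (EuclideanSpace ℝ (Fin n)))) :
      sobNorm n F s0 v0 ^ (2:ℕ) + ENNReal.ofReal (t ^ 2) * sobNorm n F s1 v1 ^ (2:ℕ) =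
        ∫⁻ ξ, (ENNReal.ofReal (besselWeight n s0 ξ) * (‖(F v0) ξ‖₊ : ℝ≥0∞) ^ (2:ℕ) +
          ENNReal.ofReal (t ^ 2) *
            (ENNReal.ofReal (besselWeight n s1 ξ) * (‖(F v1) ξ‖₊ : ℝ≥0∞) ^ (2:ℕ))) := by
    have h0 := measurable_nnnorm_Lp n (F v0)
    have h1 := measurable_nnnorm_Lp n (F v1)
    rw [sobNorm_sq, sobNorm_sq, lintegral_add_left (by fun_prop),
      lintegral_const_mul _ (by fun_prop)]
  apply le_antisymm
  · set I := ∫⁻ ξ, ENNReal.ofReal (t ^ 2 * (besselWeight n s0 ξ * besselWeight n s1 ξ /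
          (besselWeight n s0 ξ + t ^ 2 * besselWeight n s1 ξ))) *
        (‖(F u) ξ‖₊ : ℝ≥0∞) ^ (2:ℕ) with hI
    rcases eq_top_or_lt_top I with htop | htop
    · rw [htop, ENNReal.top_rpow_of_pos (by norm_num)]
      exact le_top
    let m : EuclideanSpace ℝ (Fin n) → ℝ := fun ξ =>
      t ^ 2 * besselWeight n s1 ξ / (besselWeight n s0 ξ + t ^ 2 * besselWeight n s1 ξ)
    have hm (ξ) : ‖((m ξ : ℝ) : ℂ)‖ ≤ 1 := by
      have h0 := besselWeight_pos n s0 ξ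
      have h1 := besselWeight_pos n s1 ξ
      rw [Complex.norm_real, Real.norm_of_nonneg (by positivity)]
      exact div_le_one_of_le₀ (by linarith) (by positivity)
    have hmem : MemLp (fun ξ => ((m ξ : ℝ) : ℂ) * (F u) ξ) 2 volume := by
      have hmeas : Measurable m := by fun_prop
      refine (Lp.memLp (F u)).mono ?_ (ae_of_all _ fun ξ => ?_)
      · exact (Complex.measurable_ofReal.comp hmeas).aestronglyMeasurable.mul
          (Lp.aestronglyMeasurable (F u))
      · rw [norm_mul]
        exact mul_le_of_le_one_left (norm_nonneg _) (hm ξ)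
    have hv0 := hmem.coeFn_toLp
    set v0 := hmem.toLp
    have heq : sobNorm n F s0 (F.symm v0) ^ (2:ℕ) +
        ENNReal.ofReal (t ^ 2) * sobNorm n F s1 (u - F.symm v0) ^ (2:ℕ) = I := by
      rw [hsum, hI]
      apply lintegral_congr_ae
      have hsub : F (u - F.symm v0) = F u - v0 := by simp
      rw [hsub, LinearIsometryEquiv.apply_symm_apply]
      filter_upwards [hv0, Lp.coeFn_sub (F u) v0] with ξ h0 h1
      rw [h1, Pi.sub_apply, h0]
      exact ofReal_mul_nnnorm_sq_minimizer (besselWeight_pos n s0 ξ) (besselWeight_pos n s1 ξ)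
        t _
    refine sInf_le ⟨F.symm v0, ?_, u - F.symm v0, ?_, by abel, by rw [heq]⟩
    · have h : sobNorm n F s0 (F.symm v0) ^ (2:ℕ) < ⊤ := (le_self_add.trans_eq heq).trans_lt htop
      exact (ENNReal.pow_lt_top_iff.1 h).resolve_right two_ne_zero
    · have h := (le_add_self.trans_eq heq).trans_lt htop
      have h' := ENNReal.lt_top_of_mul_ne_top_right h.ne
        (ENNReal.ofReal_pos.2 (by positivity)).ne'
      exact (ENNReal.pow_lt_top_iff.1 h').resolve_right two_ne_zero
  · refine le_sInf ?_
    rintro r ⟨u0, -, u1, -, rfl, rfl⟩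
    refine ENNReal.rpow_le_rpow ?_ (by norm_num)
    rw [hsum, map_add]
    apply lintegral_mono_ae
    filter_upwards [Lp.coeFn_add (F u0) (F u1)] with ξ h
    rw [h]
    exact ofReal_mul_nnnorm_add_sq_le (besselWeight_pos n s0 ξ) (besselWeight_pos n s1 ξ) t _ _

theorem lintegral_logMeasure (f : ℝ → ℝ≥0∞) :
    ∫⁻ t, f t ∂logMeasure = ∫⁻ t in Ioi (0:ℝ), ENNReal.ofReal t⁻¹ * f t := by
  rw [logMeasure, lintegral_withDensity_eq_lintegral_mul_non_measurable _ (by fun_prop)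
    (ae_of_all _ fun _ => ENNReal.ofReal_lt_top)]
  rfl

theorem thetaNorm2E_sobKfun {s0 s1 θ : ℝ} (hθ0 : 0 < θ) (hθ1 : θ < 1)
    (u : Lp ℂ 2 (volume : Measure (EuclideanSpace ℝ (Fin n)))) :
    thetaNorm2E θ (fun t => sobKfun n F s0 s1 t u) =
      ENNReal.ofReal (Real.pi / (2 * Real.sin (Real.pi * θ))) ^ (1/2 : ℝ) *
        sobNorm n F ((1 - θ) * s0 + θ * s1) u := by
  have hsin : 0 < Real.sin (Real.pi * θ) :=
    Real.sin_pos_of_pos_of_lt_pi (by positivity) (by nlinarith [Real.pi_pos])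
  have hmeas := measurable_nnnorm_Lp n (F u)
  rw [thetaNorm2E, sobNorm, ← ENNReal.mul_rpow_of_nonneg _ _ (by norm_num), lintegral_logMeasure]
  congr 1
  have hint (t : ℝ) (ht : t ∈ Ioi (0:ℝ)) :
      ENNReal.ofReal t⁻¹ * (ENNReal.ofReal (t ^ (-θ)) * sobKfun n F s0 s1 t u) ^ (2:ℝ) =
        ∫⁻ ξ, ENNReal.ofReal (t ^ (1 - 2 * θ) * (besselWeight n s0 ξ * besselWeight n s1 ξ /
          (besselWeight n s0 ξ + t ^ 2 * besselWeight n s1 ξ))) *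
            (‖(F u) ξ‖₊ : ℝ≥0∞) ^ (2:ℕ) := by
    have ht : 0 < t := ht
    rw [sobKfun_eq n F s0 s1 t ht, ENNReal.rpow_two, mul_pow, ENNReal.rpow_half_sq, ← mul_assoc,
      ← ENNReal.ofReal_pow (by positivity), ← ENNReal.ofReal_mul (by positivity),
      ← lintegral_const_mul _ (by fun_prop)]
    refine lintegral_congr fun ξ => ?_
    rw [← mul_assoc, ← ENNReal.ofReal_mul (by positivity), ← mul_assoc]
    have : t⁻¹ * (t ^ (-θ)) ^ 2 * t ^ 2 = t ^ (1 - 2 * θ) := by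
      rw [← Real.rpow_natCast (t ^ (-θ)), ← Real.rpow_mul ht.le,
        show 1 - 2 * θ = 1 + -θ * (2:ℕ) by push_cast; ring, Real.rpow_add ht, Real.rpow_one]
      field_simp
    rw [this]
  rw [setLIntegral_congr_fun measurableSet_Ioi hint, lintegral_lintegral_swap (by fun_prop),
    ← lintegral_const_mul _ (by fun_prop)]
  refine lintegral_congr fun ξ => ?_
  rw [lintegral_mul_const _ (by fun_prop), lintegral_rpow_div_add_sq_mul
    (besselWeight_pos n s0 ξ) (besselWeight_pos n s1 ξ) hθ0 hθ1, ← mul_assoc,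
    ← ENNReal.ofReal_mul (by positivity)]
  have hb : (0:ℝ) < 1 + ‖ξ‖ ^ 2 := by positivity
  have hw : besselWeight n s0 ξ ^ (1 - θ) * besselWeight n s1 ξ ^ θ =
      (1 + ‖ξ‖ ^ 2) ^ ((1 - θ) * s0 + θ * s1) := by
    rw [besselWeight, besselWeight, ← Real.rpow_mul hb.le, ← Real.rpow_mul hb.le,
      ← Real.rpow_add hb]
    ring_nf
  rw [hw, mul_comm (Real.pi / _)]

theorem ofReal_N2_mul {θ : ℝ} (hθ0 : 0 < θ) (hθ1 : θ < 1) :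
    ENNReal.ofReal (N2 θ) * ENNReal.ofReal (Real.pi / (2 * Real.sin (Real.pi * θ))) ^ (1/2 : ℝ) =
      1 := by
  have hsin : 0 < Real.sin (Real.pi * θ) :=
    Real.sin_pos_of_pos_of_lt_pi (by positivity) (by nlinarith [Real.pi_pos])
  rw [N2, ENNReal.ofReal_rpow_of_nonneg (by positivity) (by norm_num), ← Real.sqrt_eq_rpow,
    ← ENNReal.ofReal_mul (Real.sqrt_nonneg _), ← Real.sqrt_mul (by positivity)]
  have : 2 / Real.pi * Real.sin (Real.pi * θ) * (Real.pi / (2 * Real.sin (Real.pi * θ))) = 1 := by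
    field_simp
  simp [this]

theorem sobNorm_mono {s s' : ℝ} (h : s ≤ s')
    (u : Lp ℂ 2 (volume : Measure (EuclideanSpace ℝ (Fin n)))) :
    sobNorm n F s u ≤ sobNorm n F s' u := by
  unfold sobNorm
  gcongr with ξ
  linarith [sq_nonneg ‖ξ‖]

/-- (Theorem 4.1.) The Sobolev spaces `H^s(ℝⁿ)`, `s ≥ 0`, defined via the
Fourier–Plancherel transform `F` (the unitary map on `L²(ℝⁿ)` extending
`û(ξ) = (2π)^{-n/2} ∫ e^{-iξ·x}u(x) dx` for integrable `u`), form an exact interpolation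
scale: for `0 ≤ s0 ≤ s1`, `0 < θ < 1` and `s = (1-θ)s0 + θs1`, with normalisation
`N_{θ,2} = ((2/π) sin (πθ))^{1/2}`, `K_{θ,2}((H^{s0}(ℝⁿ), H^{s1}(ℝⁿ))) = H^s(ℝⁿ)` as sets
and `‖u‖_{K_{θ,2}}` equals `‖u‖_{H^s(ℝⁿ)}` for every `u ∈ H^s(ℝⁿ)`. -/
theorem statement16
    (hF : ∀ u : Lp ℂ 2 (volume : Measure (EuclideanSpace ℝ (Fin n))),
      Integrable (u : EuclideanSpace ℝ (Fin n) → ℂ) volume →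
      ∀ᵐ ξ : EuclideanSpace ℝ (Fin n),
        (F u) ξ =
          (((2 * Real.pi) ^ (-(n:ℝ)/2) : ℝ) : ℂ) *
            ∫ x : EuclideanSpace ℝ (Fin n), Complex.exp (-(Complex.I * ((⟪x, ξ⟫ : ℝ) : ℂ))) * u x)
    (s0 s1 : ℝ) (hs0 : 0 ≤ s0) (hs01 : s0 ≤ s1)
    (θ : ℝ) (hθ0 : 0 < θ) (hθ1 : θ < 1) :
    {u | (∃ u0 ∈ sobSet n F s0, ∃ u1 ∈ sobSet n F s1, u0 + u1 = u) ∧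
        thetaNorm2E θ (fun t => sobKfun n F s0 s1 t u) < ⊤} =
      sobSet n F ((1 - θ) * s0 + θ * s1) ∧
    ∀ u ∈ sobSet n F ((1 - θ) * s0 + θ * s1),
      sobKnorm n F s0 s1 θ u = sobNorm n F ((1 - θ) * s0 + θ * s1) u := by
  have hK (u) : sobKnorm n F s0 s1 θ u = sobNorm n F ((1 - θ) * s0 + θ * s1) u := by
    rw [sobKnorm, thetaNorm2E_sobKfun n F hθ0 hθ1, ← mul_assoc, ofReal_N2_mul hθ0 hθ1, one_mul]
  refine ⟨Set.ext fun u => ⟨fun ⟨_, hu⟩ => ?_, fun hu => ⟨⟨u, ?_, 0, ?_, add_zero u⟩, ?_⟩⟩,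
    fun u _ => hK u⟩
  · rw [sobSet, mem_ofPred_eq, ← hK]
    exact ENNReal.mul_lt_top ENNReal.ofReal_lt_top hu
  · exact (sobNorm_mono n F (by nlinarith) u).trans_lt hu
  · simp [sobSet, sobNorm]
  · rw [thetaNorm2E_sobKfun n F hθ0 hθ1]
    exact ENNReal.mul_lt_top
      (ENNReal.rpow_lt_top_of_nonneg (by norm_num) ENNReal.ofReal_ne_top) hu
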